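/- arXiv:2604.01960 — 3 statements merged into one kernel-verified Lean document; each statement's English description precedes it below -/
import Mathlib

section
/- With H_u a set of size k whose upper bounds are the k smallest, U = max_{i ∈ H_u} ub_i, and H_l = { j ∉ H_u : lb_j ≤ U }, every object i with d_i ≤ Dist_k belongs to H_u ∪ H_l; in particular, every top-k set is contained in H_u ∪ H_l. -/
/-- `kthSmallest s k` is the `k`-th smallest element (1-indexed, counted with
multiplicity) of the multiset `s` of reals. -/
noncomputable def kthSmallest (s : Multiset ℝ) (k : ℕ) : ℝ :=
  (s.sort (· ≤ ·)).getD (k - 1) 0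

/-- If at least `k ≥ 1` members of a multiset are at most `a`, so is its `k`-th smallest member. -/
theorem kthSmallest_le_of_le_countP {s : Multiset ℝ} {k : ℕ} {a : ℝ} (hk : 1 ≤ k)
    (h : k ≤ s.countP (· ≤ a)) : kthSmallest s k ≤ a := by
  have hsort : (s.sort (· ≤ ·)).Pairwise (· ≤ ·) := s.pairwise_sort (· ≤ ·)
  rw [← s.sort_eq (· ≤ ·), Multiset.coe_countP] at h
  unfold kthSmallest
  generalize s.sort (· ≤ ·) = l at h hsort ⊢
  have hlen : k - 1 < l.length := by
    have := h.trans List.countP_le_length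
    omega
  rw [List.getD_eq_getElem _ _ hlen]
  by_contra! hlt
  have hdrop : (l.drop (k - 1)).countP (fun x => decide (x ≤ a)) = 0 := by
    rw [List.countP_eq_zero]
    intro x hx
    obtain ⟨i, hi, rfl⟩ := List.mem_iff_getElem.1 hx
    rw [List.getElem_drop]
    simpa using hlt.trans_le (hsort.sortedLE.getElem_le_getElem_of_le (Nat.le_add_right (k - 1) i))
  have htake : (l.take (k - 1)).countP (fun x => decide (x ≤ a)) ≤ k - 1 :=
    List.countP_le_length.trans (List.length_take_le _ _)
  rw [← List.take_append_drop (k - 1) l, List.countP_append, hdrop] at h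
  omega

/-- **All potential top-k objects lie in `H_u ∪ H_l`.** With `H_u` a set of size `k`
whose upper bounds are the `k` smallest, `U = max_{i ∈ H_u} ub i`, and
`H_l = {j ∉ H_u : lb j ≤ U}`, every object `i` with `d i ≤ Dist_k` belongs to
`H_u ∪ H_l`; in particular, every top-`k` set is contained in `H_u ∪ H_l`. -/
theorem candidates_in_Hu_union_Hl
    (n : ℕ) (d lb ub : Fin n → ℝ)
    (hbd : ∀ i : Fin n, lb i ≤ d i ∧ d i ≤ ub i)
    (k : ℕ) (hk1 : 1 ≤ k) (hkn : k ≤ n)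
    (Hu : Finset (Fin n)) (hHu_card : Hu.card = k) (hHu_ne : Hu.Nonempty)
    (hHu_min : ∀ i ∈ Hu, ∀ j ∉ Hu, ub i ≤ ub j)
    (U : ℝ) (hU : U = Hu.sup' hHu_ne ub)
    (Hl : Finset (Fin n))
    (hHl : Hl = Finset.univ.filter (fun j => j ∉ Hu ∧ lb j ≤ U)) :
    (∀ i : Fin n,
        d i ≤ kthSmallest ((Finset.univ : Finset (Fin n)).val.map d) k →
        i ∈ Hu ∪ Hl) ∧
    (∀ T : Finset (Fin n), T.card = k → (∀ i ∈ T, ∀ j ∉ T, d i ≤ d j) →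
        T ⊆ Hu ∪ Hl) := by
  have hub : ∀ j ∈ Hu, d j ≤ U := fun j hj =>
    (hbd j).2.trans (hU ▸ Finset.le_sup' ub hj)
  have hmem : ∀ i, d i ≤ U → i ∈ Hu ∪ Hl := by
    intro i hi
    by_cases hiu : i ∈ Hu
    · exact Finset.mem_union_left _ hiu
    · refine Finset.mem_union_right _ ?_
      rw [hHl]
      exact Finset.mem_filter.2 ⟨Finset.mem_univ i, hiu, (hbd i).1.trans hi⟩
  refine ⟨fun i hi => hmem i (hi.trans (kthSmallest_le_of_le_countP hk1 ?_)), ?_⟩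
  · rw [Multiset.countP_map, ← hHu_card]
    exact Finset.card_le_card (t := Finset.univ.filter (fun j => d j ≤ U))
      fun j hj => Finset.mem_filter.2 ⟨Finset.mem_univ j, hub j hj⟩
  · intro T hT hTd i hi
    by_cases hiu : i ∈ Hu
    · exact Finset.mem_union_left _ hiu
    · have hnot : ¬ Hu ⊆ T := fun hsub =>
        hiu (Finset.eq_of_subset_of_card_le hsub (hT.trans hHu_card.symm).le ▸ hi)
      obtain ⟨j, hj, hjT⟩ := Finset.not_subset.1 hnot
      exact hmem i ((hTd i hi j hjT).trans (hub j hj))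
end

section
/- Suppose H_u (a set of size k whose upper bounds are the k smallest) is itself a top-k set, and let a ∈ H_u be an object attaining the maximum upper bound in H_u, i.e., ub_a = U = max_{i ∈ H_u} ub_i. Then lb_a ≤ Dist_k ≤ ub_a; that is, the estimated interval [lb_a, ub_a] of the top object of H_u contains the k-th smallest exact distance, so this object must be re-ranked. -/
/-- Sorting a sum of multisets, the first of which lies below the second, amounts to
concatenating the sorted summands. -/
theorem Multiset.sort_add_of_forall_le {s t : Multiset ℝ} (h : ∀ x ∈ s, ∀ y ∈ t, x ≤ y) :
    (s + t).sort (· ≤ ·) = s.sort (· ≤ ·) ++ t.sort (· ≤ ·) := by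
  refine List.Perm.eq_of_pairwise' (r := (· ≤ ·)) (Multiset.pairwise_sort _ _) ?_ ?_
  · refine List.pairwise_append.2 ⟨Multiset.pairwise_sort _ _, Multiset.pairwise_sort _ _, ?_⟩
    simpa using h
  · rw [← Multiset.coe_eq_coe, ← Multiset.coe_add]
    simp only [Multiset.sort_eq]

/-- If `s` is a nonempty multiset lying below `t`, the `card s`-th smallest element of `s + t` is
the greatest element of `s`. -/
theorem isGreatest_kthSmallest_add {s t : Multiset ℝ} (hs : s ≠ 0)
    (h : ∀ x ∈ s, ∀ y ∈ t, x ≤ y) :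
    IsGreatest {x | x ∈ s} (kthSmallest (s + t) s.card) := by
  have hpos : 0 < s.card := Multiset.card_pos.2 hs
  have hlt : s.card - 1 < (s.sort (· ≤ ·)).length := by
    rw [Multiset.length_sort]
    lia
  have hkth : kthSmallest (s + t) s.card = (s.sort (· ≤ ·))[s.card - 1] := by
    rw [kthSmallest, Multiset.sort_add_of_forall_le h, List.getD_append _ _ _ _ hlt,
      List.getD_eq_getElem _ _ hlt]
  rw [hkth]
  refine ⟨(Multiset.mem_sort (· ≤ ·)).1 (List.getElem_mem hlt), fun x hx => ?_⟩
  obtain ⟨i, hi, rfl⟩ := List.getElem_of_mem ((Multiset.mem_sort (· ≤ ·)).2 hx)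
  have hi' : i < s.card := by simpa using hi
  exact (Multiset.pairwise_sort s (· ≤ ·)).sortedLE.getElem_le_getElem_of_le (by lia)

/-- **If `H_u` is itself a top-`k` set, its top object must be re-ranked.**
With `H_u` a set of size `k` whose upper bounds are the `k` smallest, suppose `H_u`
is a top-`k` set, and let `a ∈ H_u` attain the maximum upper bound in `H_u`,
i.e. `ub a = U = max_{i ∈ H_u} ub i`.  Then `lb a ≤ Dist_k ≤ ub a`: the estimated
interval `[lb a, ub a]` of the top object of `H_u` contains the `k`-th smallest
exact distance. -/
theorem top_of_Hu_must_be_reranked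
    (n : ℕ) (d lb ub : Fin n → ℝ)
    (hbd : ∀ i : Fin n, lb i ≤ d i ∧ d i ≤ ub i)
    (k : ℕ) (hk1 : 1 ≤ k) (hkn : k ≤ n)
    (Hu : Finset (Fin n)) (hHu_card : Hu.card = k) (hHu_ne : Hu.Nonempty)
    (hHu_min : ∀ i ∈ Hu, ∀ j ∉ Hu, ub i ≤ ub j)
    (U : ℝ) (hU : U = Hu.sup' hHu_ne ub)
    (hHu_top : ∀ i ∈ Hu, ∀ j ∉ Hu, d i ≤ d j)
    (a : Fin n) (ha : a ∈ Hu) (haU : ub a = U) :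
    lb a ≤ kthSmallest ((Finset.univ : Finset (Fin n)).val.map d) k ∧
    kthSmallest ((Finset.univ : Finset (Fin n)).val.map d) k ≤ ub a := by
  have hsplit : (Finset.univ : Finset (Fin n)).val.map d = Hu.val.map d + Huᶜ.val.map d := by
    rw [← Multiset.map_add, ← Finset.disjUnion_val Hu Huᶜ disjoint_compl_right,
      Finset.disjUnion_eq_union, Finset.union_compl]
  have hgreatest : IsGreatest {x | x ∈ Hu.val.map d}
      (kthSmallest ((Finset.univ : Finset (Fin n)).val.map d) k) := by
    have hcard : (Hu.val.map d).card = k := by simpa using hHu_card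
    rw [hsplit, ← hcard]
    refine isGreatest_kthSmallest_add (by simpa using hHu_ne.ne_empty) ?_
    simpa using hHu_top
  refine ⟨(hbd a).1.trans (hgreatest.2 (Multiset.mem_map_of_mem d ha)), ?_⟩
  obtain ⟨i, hi, hdi⟩ := Multiset.mem_map.1 hgreatest.1
  rw [← hdi, haU, hU]
  exact (hbd i).2.trans (Finset.le_sup' ub hi)
end

section
/- Suppose k < n and H_l ≠ ∅. Let a ∈ H_u attain the maximum upper bound in H_u (ub_a = U = max_{i ∈ H_u} ub_i) and let b ∈ H_l attain the minimum lower bound in H_l (lb_b = min_{j ∈ H_l} lb_j). Then the object among {a, b} with the smaller lower bound is guaranteed to require re-ranking: if lb_a ≤ lb_b then lb_a ≤ Dist_k ≤ ub_a, and if lb_b < lb_a then lb_b ≤ Dist_k ≤ ub_b. -/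
theorem List.SortedLE.lt_countP_lt_of_getElem_lt {l : List ℝ} (hl : l.SortedLE) {i : ℕ}
    (hi : i < l.length) {m : ℝ} (h : l[i] < m) : i < l.countP (· < m) := by
  have htake : (l.take (i + 1)).countP (· < m) = (l.take (i + 1)).length := by
    rw [List.countP_eq_length]
    intro x hx
    obtain ⟨j, hj, rfl⟩ := List.mem_iff_getElem.1 hx
    rw [List.length_take] at hj
    rw [List.getElem_take]
    exact decide_eq_true ((hl.getElem_le_getElem_of_le (by omega)).trans_lt h)
  have hle : (l.take (i + 1)).countP (· < m) ≤ l.countP (· < m) :=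
    (List.take_sublist _ _).countP_le
  rw [htake, List.length_take] at hle
  omega

theorem List.SortedLE.countP_le_le_of_lt_getElem {l : List ℝ} (hl : l.SortedLE) {i : ℕ}
    (hi : i < l.length) {M : ℝ} (h : M < l[i]) : l.countP (· ≤ M) ≤ i := by
  have hdrop : (l.drop i).countP (· ≤ M) = 0 := by
    rw [List.countP_eq_zero]
    intro x hx
    obtain ⟨j, hj, rfl⟩ := List.mem_iff_getElem.1 hx
    rw [List.getElem_drop]
    simpa using h.trans_le (hl.getElem_le_getElem_of_le (by omega))
  rw [← List.take_append_drop i l, List.countP_append, hdrop, add_zero]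
  exact List.countP_le_length.trans (List.length_take_le _ _)

theorem kthSmallest_eq_getElem {s : Multiset ℝ} {k : ℕ}
    (h : k - 1 < (s.sort (· ≤ ·)).length) :
    kthSmallest s k = (s.sort (· ≤ ·))[k - 1] := by
  exact List.getD_eq_getElem _ _ h

theorem le_kthSmallest {s : Multiset ℝ} {k : ℕ} (hk : 1 ≤ k) (hks : k ≤ s.card) {m : ℝ}
    (h : s.countP (· < m) < k) : m ≤ kthSmallest s k := by
  have hlen : k - 1 < (s.sort (· ≤ ·)).length := by rw [Multiset.length_sort]; omega
  rw [kthSmallest_eq_getElem hlen]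
  by_contra! hlt
  have hcount := (s.pairwise_sort (· ≤ ·)).sortedLE.lt_countP_lt_of_getElem_lt hlen hlt
  rw [← Multiset.coe_countP, Multiset.sort_eq] at hcount
  omega

theorem kthSmallest_le {s : Multiset ℝ} {k : ℕ} (hk : 1 ≤ k) {M : ℝ}
    (h : k ≤ s.countP (· ≤ M)) : kthSmallest s k ≤ M := by
  have hcard := h.trans (Multiset.countP_le_card _ s)
  have hlen : k - 1 < (s.sort (· ≤ ·)).length := by rw [Multiset.length_sort]; omega
  rw [kthSmallest_eq_getElem hlen]
  by_contra! hlt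
  have hcount := (s.pairwise_sort (· ≤ ·)).sortedLE.countP_le_le_of_lt_getElem hlen hlt
  rw [← Multiset.coe_countP, Multiset.sort_eq] at hcount
  omega

theorem countP_map_univ {n : ℕ} (d : Fin n → ℝ) (p : ℝ → Prop) [DecidablePred p] :
    ((Finset.univ : Finset (Fin n)).val.map d).countP p =
      (Finset.univ.filter fun i => p (d i)).card := by
  rw [Multiset.countP_map]
  rfl

/-- **The object with the smaller lower bound among the two heap tops must be
re-ranked.**  Suppose `k < n` and `H_l ≠ ∅`.  Let `a ∈ H_u` attain the maximum
upper bound in `H_u` (`ub a = U = max_{i ∈ H_u} ub i`) and `b ∈ H_l` attain the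
minimum lower bound in `H_l`.  Then: if `lb a ≤ lb b` then
`lb a ≤ Dist_k ≤ ub a`, and if `lb b < lb a` then `lb b ≤ Dist_k ≤ ub b`. -/
theorem smaller_lower_bound_top_must_be_reranked
    (n : ℕ) (d lb ub : Fin n → ℝ)
    (hbd : ∀ i : Fin n, lb i ≤ d i ∧ d i ≤ ub i)
    (k : ℕ) (hk1 : 1 ≤ k) (hkn : k ≤ n) (hklt : k < n)
    (Hu : Finset (Fin n)) (hHu_card : Hu.card = k) (hHu_ne : Hu.Nonempty)
    (hHu_min : ∀ i ∈ Hu, ∀ j ∉ Hu, ub i ≤ ub j)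
    (U : ℝ) (hU : U = Hu.sup' hHu_ne ub)
    (Hl : Finset (Fin n))
    (hHl : Hl = Finset.univ.filter (fun j => j ∉ Hu ∧ lb j ≤ U))
    (hHl_ne : Hl.Nonempty)
    (a : Fin n) (ha : a ∈ Hu) (haU : ub a = U)
    (b : Fin n) (hb : b ∈ Hl) (hbmin : lb b = Hl.inf' hHl_ne lb) :
    (lb a ≤ lb b →
      lb a ≤ kthSmallest ((Finset.univ : Finset (Fin n)).val.map d) k ∧
      kthSmallest ((Finset.univ : Finset (Fin n)).val.map d) k ≤ ub a) ∧
    (lb b < lb a →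
      lb b ≤ kthSmallest ((Finset.univ : Finset (Fin n)).val.map d) k ∧
      kthSmallest ((Finset.univ : Finset (Fin n)).val.map d) k ≤ ub b) := by
  have hUb : ∀ i ∈ Hu, ub i ≤ U := fun i hi => hU ▸ Finset.le_sup' ub hi
  have hbHu : b ∉ Hu := by
    rw [hHl] at hb
    exact (Finset.mem_filter.1 hb).2.1
  have hle : kthSmallest ((Finset.univ : Finset (Fin n)).val.map d) k ≤ ub a := by
    apply kthSmallest_le hk1
    rw [countP_map_univ, ← hHu_card]
    refine Finset.card_le_card fun i hi => Finset.mem_filter.2 ⟨Finset.mem_univ i, ?_⟩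
    exact (hbd i).2.trans (haU ▸ hUb i hi)
  have hge : ∀ m, m ≤ lb a → m ≤ lb b →
      m ≤ kthSmallest ((Finset.univ : Finset (Fin n)).val.map d) k := by
    intro m hma hmb
    apply le_kthSmallest hk1 (by simpa using hkn)
    rw [countP_map_univ, ← hHu_card]
    refine lt_of_le_of_lt (Finset.card_le_card ?_) (Finset.card_erase_lt_of_mem ha)
    intro i hi
    have hdi : d i < m := (Finset.mem_filter.1 hi).2
    refine Finset.mem_erase.2 ⟨?_, ?_⟩
    · rintro rfl
      linarith [(hbd i).1]
    · by_contra hiHu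
      rcases le_or_gt (lb i) U with hiU | hiU
      · have hiHl : i ∈ Hl := by simp [hHl, hiHu, hiU]
        have hbi : lb b ≤ lb i := hbmin ▸ Finset.inf'_le lb hiHl
        linarith [(hbd i).1]
      · linarith [(hbd i).1, (hbd a).1, (hbd a).2]
  exact ⟨fun h => ⟨hge _ le_rfl h, hle⟩,
    fun h => ⟨hge _ h.le le_rfl, hle.trans (hHu_min a ha b hbHu)⟩⟩
end
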